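/- Let X be a Banach space and G : X → X a compact (continuous mapping sending bounded sets to relatively compact sets) map. Suppose there is M > 0 such that every x ∈ X and σ ∈ [0,1] with x = σ G(x) satisfies ‖x‖ < M. Then G has a fixed point (Leray–Schauder fixed point theorem). -/

import Mathlib

open Set Filter Topology MeasureTheory Metric

namespace LSFP

lemma det_interp {E : Type*} [NormedAddCommGroup E] [NormedSpace ℝ E] [FiniteDimensional ℝ E]
    (t : Fin (Module.finrank ℝ E + 1) → ℝ) (ht : Function.Injective t) :
    ∃ c : Fin (Module.finrank ℝ E + 1) → ℝ, ∀ A : E →L[ℝ] E,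
      (ContinuousLinearMap.id ℝ E + A).det =
        ∑ i, c i * (ContinuousLinearMap.id ℝ E + t i • A).det := by
  classical
  refine ⟨fun i => (Lagrange.basis Finset.univ t i).eval 1, fun A => ?_⟩
  let b := Module.finBasis ℝ E
  let B := LinearMap.toMatrix b b (A : E →ₗ[ℝ] E)
  let P : Polynomial ℝ :=
    Matrix.det ((Polynomial.X : Polynomial ℝ) • B.map Polynomial.C +
      (1 : Matrix _ _ ℝ).map Polynomial.C)
  have hP : ∀ s : ℝ, P.eval s = (ContinuousLinearMap.id ℝ E + s • A).det := by
    intro s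
    have h1 : (ContinuousLinearMap.id ℝ E + s • A).det = Matrix.det (1 + s • B) := by
      rw [ContinuousLinearMap.det, ← LinearMap.det_toMatrix b]
      congr 1
      simp [B]
    rw [h1]
    change Polynomial.evalRingHom s (Matrix.det _) = _
    rw [RingHom.map_det]
    congr 1
    ext i j
    simp [Matrix.one_apply, add_comm]
    split_ifs <;> simp [mul_comm]
  have hdeg : P.degree < (Finset.univ : Finset (Fin (Module.finrank ℝ E + 1))).card := by
    refine lt_of_le_of_lt Polynomial.degree_le_natDegree ?_
    have := Polynomial.natDegree_det_X_add_C_le B 1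
    simp only [Fintype.card_fin] at this
    simp only [Finset.card_univ, Fintype.card_fin]
    exact_mod_cast Nat.lt_succ_of_le this
  have h := Lagrange.eq_interpolate (v := t) ht.injOn hdeg
  have h1 := hP 1
  rw [one_smul] at h1
  rw [← h1, h, Lagrange.interpolate_apply, Polynomial.eval_finsetSum]
  refine Finset.sum_congr rfl fun i _ => ?_
  rw [Polynomial.eval_mul, Polynomial.eval_C, hP, mul_comm]

lemma bij_of_lip {E : Type*} [NormedAddCommGroup E] [CompleteSpace E]
    {ψ : E → E} {c : NNReal} (hc : c < 1) (h : LipschitzWith c ψ) :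
    Function.Bijective (fun x => x + ψ x) := by
  have key : ∀ y, ContractingWith c (fun z => y - ψ z) := by
    intro y
    refine ⟨hc, LipschitzWith.of_dist_le_mul fun a b => ?_⟩
    rw [dist_sub_left]
    exact h.dist_le_mul a b
  constructor
  · intro a b hab
    simp only at hab
    refine (key (a + ψ a)).fixedPoint_unique' (x := a) (y := b) ?_ ?_
    · simp [Function.IsFixedPt]
    · rw [hab]; simp [Function.IsFixedPt]
  · intro y
    refine ⟨(key y).fixedPoint, ?_⟩
    have := (key y).fixedPoint_isFixedPt
    simp only [Function.IsFixedPt] at this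
    exact (eq_sub_iff_add_eq.mp this.symm)

lemma lip_ext {E : Type*} [NormedAddCommGroup E] [NormedSpace ℝ E] {φ : E → E} {K : NNReal}
    (h : LipschitzOnWith K φ (closedBall 0 1)) (h0 : ∀ x, ‖x‖ = 1 → φ x = 0) :
    LipschitzWith K ((closedBall (0 : E) 1).indicator φ) := by
  have aux : ∀ x y : E, ‖x‖ ≤ 1 → 1 < ‖y‖ → dist (φ x) 0 ≤ K * dist x y := by
    intro x y hx hy
    have hcont : ContinuousOn (fun s : ℝ => ‖AffineMap.lineMap x y s‖) (Icc 0 1) := by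
      simp only [AffineMap.lineMap_apply_module]
      fun_prop
    obtain ⟨s, hs, hs1⟩ := intermediate_value_Icc (zero_le_one' ℝ) hcont
      (show (1:ℝ) ∈ Icc _ _ by simpa using ⟨hx, hy.le⟩)
    simp only at hs1
    have h1 := h.dist_le_mul x (by simpa using hx) (AffineMap.lineMap x y s)
      (by simp [hs1])
    rw [h0 _ hs1, dist_left_lineMap] at h1
    refine h1.trans ?_
    gcongr
    rw [Real.norm_of_nonneg hs.1]
    exact mul_le_of_le_one_left dist_nonneg hs.2
  refine LipschitzWith.of_dist_le_mul fun x y => ?_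
  by_cases hx : ‖x‖ ≤ 1 <;> by_cases hy : ‖y‖ ≤ 1
  · rw [indicator_of_mem (by simpa using hx), indicator_of_mem (by simpa using hy)]
    exact h.dist_le_mul x (by simpa using hx) y (by simpa using hy)
  · rw [indicator_of_mem (by simpa using hx), indicator_of_notMem (by simpa using hy)]
    exact aux x y hx (not_le.mp hy)
  · rw [indicator_of_notMem (by simpa using hx), indicator_of_mem (by simpa using hy),
      dist_comm, dist_comm x y]
    exact aux y x hy (not_le.mp hx)
  · rw [indicator_of_notMem (by simpa using hx), indicator_of_notMem (by simpa using hy)]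
    simp only [dist_self]; positivity

lemma no_retract {E : Type*} [NormedAddCommGroup E] [InnerProductSpace ℝ E]
    [FiniteDimensional ℝ E] [MeasurableSpace E] [BorelSpace E]
    (φ : E → E) (hφ : ∀ x, ‖x‖ ≤ 1 → ContDiffAt ℝ 1 φ x)
    (h0 : ∀ x, ‖x‖ = 1 → φ x = 0) (h1 : ∀ x, ‖x‖ ≤ 1 → ‖x + φ x‖ = 1) : False := by
  have hcb : IsCompact (closedBall (0 : E) 1) := isCompact_closedBall _ _
  have hcd : ContDiffOn ℝ 1 φ (closedBall 0 1) := fun x hx =>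
    (hφ x (by simpa using hx)).contDiffWithinAt
  obtain ⟨K, hK⟩ := hcd.exists_lipschitzOnWith one_ne_zero (convex_closedBall _ _) hcb
  have hlip := lip_ext hK h0
  set A : E → E →L[ℝ] E := fun x => fderiv ℝ φ x with hA
  have hder : ∀ x, ‖x‖ ≤ 1 → HasFDerivAt φ (A x) x := fun x hx =>
    ((hφ x hx).differentiableAt one_ne_zero).hasFDerivAt
  have hAc : ContinuousOn A (closedBall 0 1) := fun x hx =>
    ((hφ x (by simpa using hx)).fderiv_right (m := 0) (by simp)).continuousAt.continuousWithinAt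
  obtain ⟨C, hC⟩ := hcb.exists_bound_of_continuousOn hAc
  have hdetc : ∀ t : ℝ, ContinuousOn (fun x => (ContinuousLinearMap.id ℝ E + t • A x).det)
      (closedBall 0 1) := fun t =>
    ContinuousLinearMap.continuous_det.comp_continuousOn
      (continuousOn_const.add (hAc.const_smul t))
  have hint : ∀ t : ℝ, IntegrableOn (fun x => (ContinuousLinearMap.id ℝ E + t • A x).det)
      (ball 0 1) := fun t =>
    ((hdetc t).integrableOn_compact hcb).mono_set ball_subset_closedBall
  -- positivity near zero
  obtain ⟨δ, hδ, hpos⟩ : ∃ δ > 0, ∀ B : E →L[ℝ] E, ‖B‖ < δ →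
      0 < (ContinuousLinearMap.id ℝ E + B).det := by
    have hc : Continuous (fun B : E →L[ℝ] E => (ContinuousLinearMap.id ℝ E + B).det) :=
      ContinuousLinearMap.continuous_det.comp (continuous_const.add continuous_id)
    have : ∀ᶠ B in 𝓝 (0 : E →L[ℝ] E), 0 < (ContinuousLinearMap.id ℝ E + B).det := by
      refine hc.continuousAt.eventually_const_lt ?_
      simp [ContinuousLinearMap.det]
    obtain ⟨δ, hδ, h⟩ := Metric.eventually_nhds_iff.mp this
    exact ⟨δ, hδ, fun B hB => h (by simpa using hB)⟩
  -- small t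
  have hsmall : ∀ t : ℝ, 0 ≤ t → t * K < 1 → t * (|C| + 1) < δ →
      ∫ x in ball (0 : E) 1, (ContinuousLinearMap.id ℝ E + t • A x).det
        = (volume.real (ball (0 : E) 1)) := by
    intro t ht htK htC
    set ψ : E → E := fun x => t • (closedBall (0 : E) 1).indicator φ x with hψ
    have hl : LipschitzWith (t.toNNReal * K) ψ := by
      refine LipschitzWith.of_dist_le_mul fun x y => ?_
      have := hlip.dist_le_mul x y
      simp only [hψ, dist_smul₀, NNReal.coe_mul, Real.coe_toNNReal t ht, mul_assoc,
        Real.norm_of_nonneg ht]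
      gcongr
    have hbij := bij_of_lip (c := t.toNNReal * K) (by
      rw [← NNReal.coe_lt_coe]; simpa [ht] using htK) hl
    have hid : ∀ x : E, 1 ≤ ‖x‖ → ψ x = 0 := by
      intro x hx
      rcases hx.eq_or_lt with h | h
      · simp only [hψ]
        rw [indicator_of_mem (by simp [← h]), h0 x h.symm, smul_zero]
      · simp only [hψ]
        rw [indicator_of_notMem (by simpa using h), smul_zero]
    have himg : (fun x => x + ψ x) '' (ball 0 1) = ball 0 1 := by
      ext y
      constructor
      · rintro ⟨x, hx, rfl⟩
        by_contra hn
        have hz : 1 ≤ ‖x + ψ x‖ := by simpa using hn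
        have hzz : (x + ψ x) + ψ (x + ψ x) = x + ψ x := by rw [hid _ hz, add_zero]
        have := hbij.1 hzz
        rw [this] at hz
        have hx' : ‖x‖ < 1 := by simpa using hx
        linarith
      · intro hy
        obtain ⟨x, hx⟩ := hbij.2 y
        refine ⟨x, ?_, hx⟩
        by_contra hn
        have hz : 1 ≤ ‖x‖ := by simpa using hn
        simp only [hid x hz, add_zero] at hx
        exact hn (hx ▸ hy)
    have hcov := integral_image_eq_integral_abs_det_fderiv_smul (volume : Measure E)
      (s := ball 0 1) (f := fun x => x + ψ x)
      (f' := fun x => ContinuousLinearMap.id ℝ E + t • A x) measurableSet_ball (by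
        intro x hx
        have hx' : ‖x‖ < 1 := by simpa using hx
        refine HasFDerivAt.hasFDerivWithinAt ?_
        refine (hasFDerivAt_id x).add ?_
        refine ((hder x hx'.le).const_smul t).congr_of_eventuallyEq ?_
        filter_upwards [isOpen_ball.mem_nhds hx] with y hy
        simp only [hψ]
        rw [indicator_of_mem (ball_subset_closedBall hy)]
        rfl) hbij.1.injOn (fun _ => (1 : ℝ))
    rw [himg] at hcov
    simp only [integral_const, smul_eq_mul, mul_one, MeasurableSet.univ, measureReal_restrict_apply,
      univ_inter] at hcov
    rw [hcov]
    refine setIntegral_congr_fun measurableSet_ball fun x hx => ?_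
    refine (abs_of_pos (hpos _ ?_)).symm
    rw [norm_smul, Real.norm_of_nonneg ht]
    refine lt_of_le_of_lt ?_ htC
    gcongr
    have := hC x (ball_subset_closedBall hx)
    linarith [le_abs_self C]
  -- nodes
  obtain ⟨τ, hτ, hτK, hτC⟩ : ∃ τ : ℝ, 0 < τ ∧ τ * K < 1 ∧ τ * (|C| + 1) < δ := by
    have e1 : ∀ᶠ τ in 𝓝[>] (0 : ℝ), τ * (K : ℝ) < 1 := by
      refine Filter.Eventually.filter_mono nhdsWithin_le_nhds ?_
      exact (continuous_id.mul continuous_const).continuousAt.eventually_lt_const (by simp)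
    have e2 : ∀ᶠ τ in 𝓝[>] (0 : ℝ), τ * (|C| + 1) < δ := by
      refine Filter.Eventually.filter_mono nhdsWithin_le_nhds ?_
      exact (continuous_id.mul continuous_const).continuousAt.eventually_lt_const (by simpa)
    obtain ⟨τ, h⟩ := ((eventually_mem_nhdsWithin (a := (0 : ℝ)) (s := Ioi 0)).and (e1.and e2)).exists
    exact ⟨τ, h.1, h.2.1, h.2.2⟩
  let t : Fin (Module.finrank ℝ E + 1) → ℝ := fun i => τ / (i + 1)
  have htinj : Function.Injective t := by
    intro i j hij
    simp only [t] at hij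
    rw [div_eq_div_iff (by positivity) (by positivity)] at hij
    have := mul_left_cancel₀ hτ.ne' hij
    ext
    have : (j : ℝ) = i := by linarith
    exact_mod_cast this.symm
  have htpos : ∀ i, 0 ≤ t i := fun i => by positivity
  have htle : ∀ i, t i ≤ τ := fun i => div_le_self hτ.le (by linarith [Nat.cast_nonneg (α := ℝ) i])
  obtain ⟨c, hc⟩ := det_interp t htinj
  have hsum : ∑ i, c i = 1 := by
    have := hc 0
    simpa [ContinuousLinearMap.det] using this.symm
  have hI : ∫ x in ball (0 : E) 1, (ContinuousLinearMap.id ℝ E + A x).det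
      = volume.real (ball (0 : E) 1) := by
    rw [setIntegral_congr_fun measurableSet_ball fun x _ => hc (A x)]
    rw [integral_finsetSum _ fun i _ => (hint (t i)).const_mul (c i)]
    simp_rw [integral_const_mul]
    refine Eq.trans ?_ (show ∑ i, c i * volume.real (ball (0 : E) 1) = _ by
      rw [← Finset.sum_mul, hsum, one_mul])
    refine Finset.sum_congr rfl fun i _ => ?_
    rw [hsmall (t i) (htpos i) ?_ ?_]
    · exact lt_of_le_of_lt (by gcongr; exact htle i) hτK
    · exact lt_of_le_of_lt (by gcongr; exact htle i) hτC
  have hzero : ∀ x ∈ ball (0 : E) 1, (ContinuousLinearMap.id ℝ E + A x).det = 0 := by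
    intro x hx
    have hx' : ‖x‖ < 1 := by simpa using hx
    by_contra hne
    have hd : HasFDerivAt (fun y => y + φ y) (ContinuousLinearMap.id ℝ E + A x) x :=
      (hasFDerivAt_id x).add (hder x hx'.le)
    have hd2 := hd.norm_sq
    have hd3 : HasFDerivAt (fun y => ‖y + φ y‖ ^ 2) (0 : E →L[ℝ] ℝ) x := by
      refine (hasFDerivAt_const (1 : ℝ) x).congr_of_eventuallyEq ?_
      filter_upwards [isOpen_ball.mem_nhds hx] with y hy
      rw [h1 y (by simpa using (ball_subset_closedBall hy)), one_pow]
    have hu := hd2.unique hd3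
    obtain ⟨w, hw⟩ := (LinearMap.equivOfDetNeZero
      ((ContinuousLinearMap.id ℝ E + A x : E →L[ℝ] E) : E →ₗ[ℝ] E) hne).surjective (x + φ x)
    have hw' : (ContinuousLinearMap.id ℝ E + A x) w = x + φ x := hw
    have := congrArg (fun L : E →L[ℝ] ℝ => L w) hu
    simp only [smul_apply, ContinuousLinearMap.comp_apply, hw',
      innerSL_apply_apply, real_inner_self_eq_norm_sq, h1 x hx'.le] at this
    simp at this
  rw [setIntegral_congr_fun measurableSet_ball hzero] at hI
  simp only [integral_zero] at hI
  have hv : 0 < volume.real (ball (0 : E) 1) :=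
    ENNReal.toReal_pos (measure_ball_pos _ _ one_pos).ne' measure_ball_lt_top.ne
  linarith

lemma no_field {E : Type*} [NormedAddCommGroup E] [InnerProductSpace ℝ E]
    [FiniteDimensional ℝ E] [MeasurableSpace E] [BorelSpace E]
    (v : E → E) (hv : ContDiff ℝ 1 v) (hne : ∀ x, ‖x‖ ≤ 1 → v x ≠ 0)
    (hs : ∀ x, ‖x‖ = 1 → 0 < inner ℝ x (v x)) : False := by
  have hdisc : ∀ x, ‖x‖ ≤ 1 → 0 < (inner ℝ x (v x)) ^ 2 + ‖v x‖ ^ 2 * (1 - ‖x‖ ^ 2) := by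
    intro x hx
    have hvx : 0 < ‖v x‖ := norm_pos_iff.mpr (hne x hx)
    rcases hx.eq_or_lt with h | h
    · have := hs x h
      rw [h]
      simp only [one_pow, sub_self, mul_zero, add_zero]
      positivity
    · have : 0 < 1 - ‖x‖ ^ 2 := by nlinarith [norm_nonneg x]
      positivity
  refine no_retract (fun x => ((-inner ℝ x (v x) +
    √((inner ℝ x (v x)) ^ 2 + ‖v x‖ ^ 2 * (1 - ‖x‖ ^ 2))) / ‖v x‖ ^ 2) • v x) ?_ ?_ ?_
  · intro x hx
    have hvx : ‖v x‖ ^ 2 ≠ 0 := pow_ne_zero _ (norm_ne_zero_iff.mpr (hne x hx))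
    have hi : ContDiffAt ℝ 1 (fun x => inner ℝ x (v x)) x :=
      contDiffAt_id.inner ℝ hv.contDiffAt
    have hq : ContDiffAt ℝ 1 (fun x => ‖v x‖ ^ 2) x := hv.contDiffAt.norm_sq ℝ
    have hq' : ContDiffAt ℝ 1 (fun x : E => ‖x‖ ^ 2) x := contDiffAt_id.norm_sq ℝ
    refine ContDiffAt.smul (ContDiffAt.div (hi.neg.add (ContDiffAt.sqrt ?_ (hdisc x hx).ne')) hq hvx)
      hv.contDiffAt
    exact (hi.pow 2).add (hq.mul (contDiffAt_const.sub hq'))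
  · intro x hx
    have := hs x hx
    simp only [hx]
    rw [one_pow, sub_self, mul_zero, add_zero, Real.sqrt_sq this.le]
    simp
  · intro x hx
    have hvx : ‖v x‖ ≠ 0 := (norm_ne_zero_iff.mpr (hne x hx))
    have hsq := Real.sq_sqrt (hdisc x hx).le
    set a := inner ℝ x (v x)
    set r := √(a ^ 2 + ‖v x‖ ^ 2 * (1 - ‖x‖ ^ 2))
    have : ‖x + ((-a + r) / ‖v x‖ ^ 2) • v x‖ ^ 2 = 1 := by
      rw [norm_add_sq_real, inner_smul_right, norm_smul, mul_pow, Real.norm_eq_abs, sq_abs]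
      change ‖x‖ ^ 2 + 2 * ((-a + r) / ‖v x‖ ^ 2 * a) + _ = 1
      field_simp
      nlinarith
    exact (pow_eq_one_iff_of_nonneg (norm_nonneg _) two_ne_zero).mp this

lemma exists_zero {E : Type*} [NormedAddCommGroup E] [InnerProductSpace ℝ E]
    [FiniteDimensional ℝ E] [MeasurableSpace E] [BorelSpace E]
    (v : E → E) (hv : Continuous v)
    (hs : ∀ x, ‖x‖ = 1 → 0 < inner ℝ x (v x)) : ∃ x, v x = 0 := by
  by_contra! hne
  have hcb : IsCompact (closedBall (0 : E) 1) := isCompact_closedBall _ _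
  have hcs : IsCompact (sphere (0 : E) 1) := isCompact_sphere _ _
  obtain ⟨ε, hε, h1⟩ := hcb.exists_forall_le' (f := fun x => ‖v x‖) hv.norm.continuousOn
    (a := 0) (fun x _ => norm_pos_iff.mpr (hne x))
  obtain ⟨δ, hδ, h2⟩ := hcs.exists_forall_le' (f := fun x => inner ℝ x (v x))
    (continuous_id.inner hv).continuousOn
    (a := 0) (fun x hx => hs x (by simpa using hx))
  obtain ⟨g, hg, hd, -⟩ := hv.exists_contDiff_approx 1 (ε := fun _ => min ε δ) continuous_const
    (fun _ => lt_min hε hδ)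
  refine no_field g hg ?_ ?_
  · intro x hx h0
    have := hd x
    rw [h0, dist_zero_left] at this
    have h3 := h1 x (by simpa using hx)
    linarith [min_le_left ε δ]
  · intro x hx
    have h3 := h2 x (by simpa using hx)
    have h4 := hd x
    rw [dist_eq_norm] at h4
    have h5 := abs_real_inner_le_norm x (g x - v x)
    rw [hx, one_mul, inner_sub_right] at h5
    have := neg_abs_le (inner ℝ x (g x) - inner ℝ x (v x))
    linarith [min_le_right ε δ]

lemma fix_euclid {E : Type*} [NormedAddCommGroup E] [InnerProductSpace ℝ E]
    [FiniteDimensional ℝ E] [MeasurableSpace E] [BorelSpace E]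
    (T : E → E) (hT : Continuous T) (R : ℝ) (hR : ∀ x, ‖T x‖ ≤ R) : ∃ x, T x = x := by
  have hR0 : 0 ≤ R := (norm_nonneg _).trans (hR 0)
  have hS : 0 < R + 1 := by linarith
  obtain ⟨x, hx⟩ := exists_zero (fun x => x - (R + 1)⁻¹ • T ((R + 1) • x)) (by fun_prop) (by
    intro x hx
    rw [inner_sub_right, inner_smul_right, real_inner_self_eq_norm_sq, hx]
    have h1 := real_inner_le_norm x (T ((R + 1) • x))
    rw [hx, one_mul] at h1
    have h2 := h1.trans (hR _)
    have h3 : (R + 1)⁻¹ * inner ℝ x (T ((R + 1) • x)) ≤ (R + 1)⁻¹ * R := by gcongr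
    have h4 : (R + 1)⁻¹ * R < 1 := by
      rw [inv_mul_lt_iff₀ hS]; linarith
    linarith)
  refine ⟨(R + 1) • x, ?_⟩
  have := sub_eq_zero.mp hx
  conv_rhs => rw [this]
  rw [smul_inv_smul₀ hS.ne']

lemma fix_findim {F : Type*} [NormedAddCommGroup F] [NormedSpace ℝ F] [FiniteDimensional ℝ F]
    (T : F → F) (hT : Continuous T) (R : ℝ) (hR : ∀ x, ‖T x‖ ≤ R) : ∃ x, T x = x := by
  let e : F ≃L[ℝ] EuclideanSpace ℝ (Fin (Module.finrank ℝ F)) := toEuclidean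
  obtain ⟨x, hx⟩ := fix_euclid (fun x => e (T (e.symm x)))
    (e.continuous.comp (hT.comp e.symm.continuous)) (‖e.toContinuousLinearMap‖ * R) (fun x =>
      (e.toContinuousLinearMap.le_opNorm _).trans (mul_le_mul_of_nonneg_left (hR _) (norm_nonneg _)))
  exact ⟨e.symm x, e.injective (by simpa using hx)⟩

/-- Approximate fixed points of a continuous map with range in a compact set. -/
lemma approx_fix {X : Type*} [NormedAddCommGroup X] [NormedSpace ℝ X]
    (T : X → X) (hT : Continuous T) (K : Set X) (hK : IsCompact K) (hTK : ∀ x, T x ∈ K)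
    (ε : ℝ) (hε : 0 < ε) : ∃ x, ‖T x - x‖ ≤ ε := by
  obtain ⟨s, -, hsf, hs⟩ := hK.finite_cover_balls hε
  obtain ⟨R, hR⟩ := hK.isBounded.exists_norm_le
  lift s to Finset X using hsf
  let w : X → X → ℝ := fun k y => max 0 (ε - ‖y - k‖)
  have hw : ∀ k, Continuous (w k) := fun k => by fun_prop
  have hw0 : ∀ k y, 0 ≤ w k y := fun k y => le_max_left _ _
  have hW : ∀ x, 0 < ∑ k ∈ s, w k (T x) := by
    intro x
    have := hs (hTK x)
    simp only [mem_iUnion, exists_prop] at this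
    obtain ⟨k, hk, hk2⟩ := this
    refine Finset.sum_pos' (fun k _ => hw0 k _) ⟨k, hk, lt_max_of_lt_right ?_⟩
    rw [mem_ball, dist_eq_norm] at hk2
    linarith
  let P : X → X := fun x => (∑ k ∈ s, w k (T x))⁻¹ • ∑ k ∈ s, w k (T x) • k
  have hP : Continuous P := by
    refine Continuous.smul (Continuous.inv₀ ?_ fun x => (hW x).ne') ?_
    · exact continuous_finsetSum _ fun k _ => (hw k).comp hT
    · exact continuous_finsetSum _ fun k _ => ((hw k).comp hT).smul continuous_const
  have hPd : ∀ x, ‖T x - P x‖ ≤ ε := by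
    intro x
    have e : T x - P x = (∑ k ∈ s, w k (T x))⁻¹ • ∑ k ∈ s, w k (T x) • (T x - k) := by
      simp only [smul_sub, Finset.sum_sub_distrib, ← Finset.sum_smul, P]
      rw [inv_smul_smul₀ (hW x).ne']
    rw [e, norm_smul, norm_inv, Real.norm_of_nonneg (hW x).le, inv_mul_le_iff₀ (hW x),
      Finset.sum_mul]
    refine (norm_sum_le _ _).trans (Finset.sum_le_sum fun k _ => ?_)
    rw [norm_smul, Real.norm_of_nonneg (hw0 _ _)]
    by_cases h : ‖T x - k‖ ≤ ε
    · gcongr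
    · have : w k (T x) = 0 := max_eq_left (by linarith)
      simp [this]
  let F : Submodule ℝ X := Submodule.span ℝ (s : Set X)
  have : FiniteDimensional ℝ F := FiniteDimensional.span_finset ℝ s
  have hPF : ∀ x, P x ∈ F := fun x =>
    F.smul_mem _ (F.sum_mem fun k hk => F.smul_mem _ (Submodule.subset_span hk))
  obtain ⟨x, hx⟩ := fix_findim (fun x : F => (⟨P x, hPF x⟩ : F))
    ((hP.comp continuous_subtype_val).subtype_mk _) (R + ε) (by
      intro x
      change ‖P x‖ ≤ _
      have h1 := norm_sub_norm_le (P x) (T x)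
      rw [norm_sub_rev] at h1
      linarith [hPd x, hR _ (hTK x)])
  have hx' : P x = x := congrArg Subtype.val hx
  refine ⟨x, ?_⟩
  have := hPd x
  rwa [hx'] at this

lemma schauder {X : Type*} [NormedAddCommGroup X] [NormedSpace ℝ X]
    (T : X → X) (hT : Continuous T) (K : Set X) (hK : IsCompact K) (hTK : ∀ x, T x ∈ K) :
    ∃ x, T x = x := by
  choose u hu using fun n : ℕ => approx_fix T hT K hK hTK (1 / ((n : ℝ) + 1)) (by positivity)
  obtain ⟨y, -, σ, hσ, hlim⟩ := hK.tendsto_subseq (x := fun n => T (u n)) (fun n => hTK _)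
  have hz : Tendsto (fun n => T (u n) - u n) atTop (𝓝 0) :=
    squeeze_zero_norm hu tendsto_one_div_add_atTop_nhds_zero_nat
  have hul : Tendsto (fun n => u (σ n)) atTop (𝓝 y) := by
    have := hlim.sub (hz.comp hσ.tendsto_atTop)
    simpa [Function.comp_def] using this
  exact ⟨y, tendsto_nhds_unique ((hT.tendsto y).comp hul) hlim⟩

end LSFP

theorem leray_schauder_fixed_point {X : Type*} [NormedAddCommGroup X]
    [NormedSpace ℝ X] [CompleteSpace X]
    (G : X → X) (hGcont : Continuous G)
    (hGcompact : ∀ s : Set X, Bornology.IsBounded s → IsCompact (closure (G '' s)))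
    (M : ℝ) (hM : 0 < M)
    (hbound : ∀ (x : X) (σ : ℝ), σ ∈ Set.Icc (0 : ℝ) 1 → x = σ • G x → ‖x‖ < M) :
    ∃ x : X, G x = x := by
  have hmax : ∀ x : X, 0 < max M ‖x‖ := fun x => lt_max_of_lt_left hM
  let ρ : X → X := fun x => (M / max M ‖x‖) • x
  have hρ : Continuous ρ := by
    refine Continuous.smul (Continuous.div continuous_const ?_ fun x => (hmax x).ne') continuous_id
    fun_prop
  have hρb : ∀ x, ρ x ∈ Metric.closedBall (0 : X) M := by
    intro x
    rw [mem_closedBall_zero_iff, norm_smul, Real.norm_of_nonneg (by positivity),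
      div_mul_eq_mul_div, div_le_iff₀ (hmax x)]
    gcongr
    exact le_max_right _ _
  obtain ⟨x, hx⟩ := LSFP.schauder (fun x => G (ρ x)) (hGcont.comp hρ) _
    (hGcompact _ Metric.isBounded_closedBall)
    (fun x => subset_closure ⟨_, hρb x, rfl⟩)
  by_cases h : ‖x‖ ≤ M
  · have : ρ x = x := by simp [ρ, max_eq_left h, hM.ne']
    exact ⟨x, by rwa [this] at hx⟩
  · exfalso
    push Not at h
    have hx0 : 0 < ‖x‖ := hM.trans h
    have hr : ρ x = (M / ‖x‖) • x := by simp only [ρ, max_eq_right h.le]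
    have h1 := hbound (ρ x) (M / ‖x‖) ⟨by positivity, by rw [div_le_one hx0]; exact h.le⟩
      (by rw [hx, hr])
    rw [hr, norm_smul, Real.norm_of_nonneg (by positivity), div_mul_cancel₀ _ hx0.ne'] at h1
    exact lt_irrefl _ h1
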